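/- arXiv:0901.1743 — 8 statements merged into one kernel-verified Lean document; each statement's English description precedes it below -/
import Mathlib

section
/- The operators Π(I) form a projective unitary representation of G with multiplier ω: for all I, J ∈ G one has Π(I)∘Π(J) = ω(I,J)·Π(I+J); in particular Π(0) = 1. -/
open scoped BigOperators InnerProductSpace
open Filter Topology Finset

noncomputable section

/-- The symplectic form `σ(k,l) = k₁l₂ − k₂l₁` on `R × R`. -/
def symp {R : Type*} [CommRing R] (k l : R × R) : R := k.1 * l.2 - k.2 * l.1

/-- Matrix–vector product of a `2 × 2` matrix with a pair. -/
def mvec {R : Type*} [CommRing R] (A : Matrix (Fin 2) (Fin 2) R) (k : R × R) : R × R :=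
  (A 0 0 * k.1 + A 0 1 * k.2, A 1 0 * k.1 + A 1 1 * k.2)

/-- The consistency condition `σ(k, A(−n)·l) = −σ(l, A(n)·k)` on the defining matrices. -/
def Consistent (d : ℕ) (A : ℤ → Matrix (Fin 2) (Fin 2) (ZMod d)) : Prop :=
  ∀ (n : ℤ) (k l : ZMod d × ZMod d),
    symp k (mvec (A (-n)) l) = - symp l (mvec (A n) k)

/-- `c(I,J) = Σ_{a>b} σ(I(a), A(b−a)·J(b)) + Σ_a (I(a))₁·(J(a))₂ ∈ ZMod d`. -/
def cExp (d : ℕ) (A : ℤ → Matrix (Fin 2) (Fin 2) (ZMod d))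
    (I J : ℤ →₀ (ZMod d × ZMod d)) : ZMod d :=
  (∑ a ∈ I.support, ∑ b ∈ J.support,
      if b < a then symp (I a) (mvec (A (b - a)) (J b)) else 0)
    + ∑ a ∈ I.support, (I a).1 * (J a).2

/-- The multiplier `ω(I,J) = exp(2πi·c(I,J)/d)` (using the representative `(c(I,J)).val`). -/
def omegaMul (d : ℕ) (A : ℤ → Matrix (Fin 2) (Fin 2) (ZMod d))
    (I J : ℤ →₀ (ZMod d × ZMod d)) : ℂ :=
  Complex.exp (2 * Real.pi * Complex.I * ((cExp d A I J).val : ℂ) / d)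

/-- The commutation exponent `B(I,J) = Σ_{a,b} σ(I(a), A(b−a)·J(b)) ∈ ZMod d`. -/
def Bexp (d : ℕ) (A : ℤ → Matrix (Fin 2) (Fin 2) (ZMod d))
    (I J : ℤ →₀ (ZMod d × ZMod d)) : ZMod d :=
  ∑ a ∈ I.support, ∑ b ∈ J.support, symp (I a) (mvec (A (b - a)) (J b))

/-- The Hilbert space `ℓ²(G)` over the group `G` of finitely supported functions
`ℤ → (ZMod d)²`. -/
abbrev HS (d : ℕ) := lp (fun _ : ℤ →₀ (ZMod d × ZMod d) => ℂ) 2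

/-- The standard orthonormal basis vector `e_J` of `ℓ²(G)`. -/
def eVec (d : ℕ) (J : ℤ →₀ (ZMod d × ZMod d)) : HS d := lp.single 2 J 1

/-- The shift on `G`: `(S I)(n) = I(n − 1)`. -/
def Sg {d : ℕ} (I : ℤ →₀ (ZMod d × ZMod d)) : ℤ →₀ (ZMod d × ZMod d) :=
  Finsupp.equivMapDomain (Equiv.addRight (1 : ℤ)) I

lemma cExp_eq (d : ℕ) (A : ℤ → Matrix (Fin 2) (Fin 2) (ZMod d))
    (I J : ℤ →₀ (ZMod d × ZMod d)) (S : Finset ℤ) (hI : I.support ⊆ S) (hJ : J.support ⊆ S) :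
    cExp d A I J = (∑ a ∈ S, ∑ b ∈ S,
      if b < a then symp (I a) (mvec (A (b - a)) (J b)) else 0)
    + ∑ a ∈ S, (I a).1 * (J a).2 := by
  unfold cExp
  congr 1
  · rw [Finset.sum_subset hI]
    · refine Finset.sum_congr rfl fun a _ => Finset.sum_subset hJ ?_
      intro b _ hb
      have : J b = 0 := by simpa using hb
      simp [this, symp, mvec]
    · intro a _ ha
      have : I a = 0 := by simpa using ha
      simp [this, symp]
  · apply Finset.sum_subset hI
    intro a _ ha
    have : I a = 0 := by simpa using ha
    simp [this]

lemma cExp_add_left (d : ℕ) (A : ℤ → Matrix (Fin 2) (Fin 2) (ZMod d))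
    (I J K : ℤ →₀ (ZMod d × ZMod d)) :
    cExp d A (I + J) K = cExp d A I K + cExp d A J K := by
  classical
  set S := I.support ∪ J.support ∪ K.support with hS
  have h1 : I.support ⊆ S := by intro x; simp [hS]; tauto
  have h2 : J.support ⊆ S := by intro x; simp [hS]; tauto
  have h3 : K.support ⊆ S := by intro x; simp [hS]; tauto
  have h4 : (I + J).support ⊆ S := Finsupp.support_add.trans (Finset.union_subset h1 h2)
  rw [cExp_eq d A _ _ S h4 h3, cExp_eq d A _ _ S h1 h3, cExp_eq d A _ _ S h2 h3,
    add_add_add_comm]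
  refine congrArg₂ (· + ·) ?_ ?_
  · rw [← Finset.sum_add_distrib]
    refine Finset.sum_congr rfl fun a _ => ?_
    rw [← Finset.sum_add_distrib]
    refine Finset.sum_congr rfl fun b _ => ?_
    split_ifs
    · simp [symp]; ring
    · simp
  · rw [← Finset.sum_add_distrib]
    refine Finset.sum_congr rfl fun a _ => ?_
    simp; ring

lemma cExp_add_right (d : ℕ) (A : ℤ → Matrix (Fin 2) (Fin 2) (ZMod d))
    (I J K : ℤ →₀ (ZMod d × ZMod d)) :
    cExp d A I (J + K) = cExp d A I J + cExp d A I K := by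
  classical
  set S := I.support ∪ J.support ∪ K.support with hS
  have h1 : I.support ⊆ S := by intro x; simp [hS]; tauto
  have h2 : J.support ⊆ S := by intro x; simp [hS]; tauto
  have h3 : K.support ⊆ S := by intro x; simp [hS]; tauto
  have h4 : (J + K).support ⊆ S := Finsupp.support_add.trans (Finset.union_subset h2 h3)
  rw [cExp_eq d A _ _ S h1 h4, cExp_eq d A _ _ S h1 h2, cExp_eq d A _ _ S h1 h3,
    add_add_add_comm]
  refine congrArg₂ (· + ·) ?_ ?_
  · rw [← Finset.sum_add_distrib]
    refine Finset.sum_congr rfl fun a _ => ?_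
    rw [← Finset.sum_add_distrib]
    refine Finset.sum_congr rfl fun b _ => ?_
    split_ifs
    · simp [symp, mvec]; ring
    · simp
  · rw [← Finset.sum_add_distrib]
    refine Finset.sum_congr rfl fun a _ => ?_
    simp; ring

lemma omegaMul_eq (d : ℕ) [NeZero d] (A : ℤ → Matrix (Fin 2) (Fin 2) (ZMod d))
    (I J : ℤ →₀ (ZMod d × ZMod d)) :
    omegaMul d A I J = ZMod.stdAddChar (cExp d A I J) := by
  rw [ZMod.stdAddChar_apply, ZMod.toCircle_apply, omegaMul]

lemma HS_ext (d : ℕ) (S T : HS d →L[ℂ] HS d) (h : ∀ J, S (eVec d J) = T (eVec d J)) : S = T := by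
  apply lp.ext_continuousLinearMap (by norm_num)
  intro J
  ext
  have := h J
  simp only [eVec] at this
  simp [this]

/-- The operators `Π(I)` form a projective unitary representation of `G` with
multiplier `ω`: `Π(I)∘Π(J) = ω(I,J)·Π(I+J)` for all `I, J ∈ G`; in particular `Π(0) = 1`. -/
theorem stmt1 (d : ℕ) (hd : 2 ≤ d)
    (A : ℤ → Matrix (Fin 2) (Fin 2) (ZMod d)) (hA0 : A 0 = 1) (hA : Consistent d A)
    (rep : (ℤ →₀ (ZMod d × ZMod d)) → (HS d →L[ℂ] HS d))
    (hrep : ∀ I J, rep I (eVec d J) = omegaMul d A I J • eVec d (I + J)) :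
    (∀ I J, rep I ∘L rep J = omegaMul d A I J • rep (I + J)) ∧ rep 0 = 1 := by
  have : NeZero d := ⟨by omega⟩
  constructor
  · intro I J
    apply HS_ext
    intro K
    simp only [ContinuousLinearMap.comp_apply, _root_.smul_apply, hrep, map_smul,
      smul_smul, omegaMul_eq, ← AddChar.map_add_eq_mul, cExp_add_left, cExp_add_right, add_assoc]
    congr 2
    ring
  · apply HS_ext
    intro K
    rw [hrep, omegaMul_eq]
    simp [cExp]
end
end

section
/- Under the consistency condition on the defining matrices, the commutation exponent B is antisymmetric: B(I,J) = −B(J,I) for all I, J ∈ G, and moreover B(I,I) = 0 in ZMod d for every I ∈ G. -/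
open scoped BigOperators InnerProductSpace
open Filter Topology Finset

noncomputable section

/-- Under the consistency condition, the commutation exponent `B` is
antisymmetric, `B(I,J) = −B(J,I)`, and `B(I,I) = 0` in `ZMod d` for every `I ∈ G`. -/
theorem stmt3 (d : ℕ) (hd : 2 ≤ d)
    (A : ℤ → Matrix (Fin 2) (Fin 2) (ZMod d)) (hA0 : A 0 = 1) (hA : Consistent d A) :
    (∀ I J : ℤ →₀ (ZMod d × ZMod d), Bexp d A I J = - Bexp d A J I) ∧
      ∀ I : ℤ →₀ (ZMod d × ZMod d), Bexp d A I I = 0 := by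
  have key : ∀ (I J : ℤ →₀ (ZMod d × ZMod d)) (a b : ℤ),
      symp (I a) (mvec (A (b - a)) (J b)) = - symp (J b) (mvec (A (a - b)) (I a)) := by
    intro I J a b
    have h := hA (a - b) (I a) (J b)
    rwa [neg_sub] at h
  constructor
  · intro I J
    unfold Bexp
    rw [Finset.sum_comm, ← Finset.sum_neg_distrib]
    refine Finset.sum_congr rfl fun b _ => ?_
    rw [← Finset.sum_neg_distrib]
    exact Finset.sum_congr rfl fun a _ => key I J a b
  · intro I
    unfold Bexp
    rw [← Finset.sum_product']
    refine Finset.sum_involution (fun p _ => (p.2, p.1)) ?_ ?_ ?_ ?_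
    · rintro ⟨a, b⟩ _
      simp only
      rw [key I I a b]
      ring
    · rintro ⟨a, b⟩ _ hne heq
      apply hne
      have hab : b = a := (Prod.mk.inj heq).1
      subst hab
      simp [hA0, symp, mvec]
      ring
    · rintro ⟨a, b⟩ h
      rw [Finset.mem_product] at h ⊢
      exact ⟨h.2, h.1⟩
    · rintro ⟨a, b⟩ _
      rfl
end
end

section
/- The shift automorphism is unitarily implemented in the regular representation: let S : G → G be the shift (S I)(n) := I(n−1) and let V be the unitary on ℓ²(G) determined by V e_J = e_{S J}. Then V∘Π(I)∘V⁻¹ = Π(S I) for every I ∈ G; consequently the tracial state τ(X) := ⟨e₀, X e₀⟩ is shift invariant: τ(Π(S I)) = τ(Π(I)) for all I ∈ G. -/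
open scoped BigOperators InnerProductSpace
open Filter Topology Finset

noncomputable section

theorem Sg_apply' {d : ℕ} (I : ℤ →₀ (ZMod d × ZMod d)) (a : ℤ) : Sg I (a + 1) = I a := by
  simp [Sg, Finsupp.equivMapDomain_apply]

theorem Sg_add' {d : ℕ} (I J : ℤ →₀ (ZMod d × ZMod d)) : Sg (I + J) = Sg I + Sg J := by
  ext a <;> simp [Sg, Finsupp.equivMapDomain_apply]

theorem Sg_zero' {d : ℕ} : Sg (0 : ℤ →₀ (ZMod d × ZMod d)) = 0 := by
  ext a <;> simp [Sg, Finsupp.equivMapDomain_apply]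

theorem cExp_Sg (d : ℕ) (A : ℤ → Matrix (Fin 2) (Fin 2) (ZMod d))
    (I J : ℤ →₀ (ZMod d × ZMod d)) : cExp d A (Sg I) (Sg J) = cExp d A I J := by
  have hs : ∀ K : ℤ →₀ (ZMod d × ZMod d),
      (Sg K).support = K.support.map (Equiv.addRight (1 : ℤ)).toEmbedding := fun K => rfl
  unfold cExp
  rw [hs, hs]
  simp only [Finset.sum_map, Equiv.coe_toEmbedding, Equiv.coe_addRight, Sg_apply',
    add_lt_add_iff_right, add_sub_add_right_eq_sub]

theorem ext_eVec (d : ℕ) (f g : HS d →L[ℂ] HS d) (h : ∀ J, f (eVec d J) = g (eVec d J)) :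
    f = g := by
  ext1 x
  have hx := lp.hasSum_single (p := 2) (by norm_num) x
  have e : ∀ J, f (lp.single 2 J (x J)) = g (lp.single 2 J (x J)) := by
    intro J
    have : (lp.single 2 J (x J) : HS d) = x J • eVec d J := by
      rw [eVec, ← lp.single_smul]; simp
    rw [this, map_smul, map_smul, h]
  have h1 := hx.mapL f
  have h2 := hx.mapL g
  simp only [e] at h1
  exact h1.unique h2

/-- The shift automorphism is unitarily implemented in the regular
representation: if `V` is the unitary of `ℓ²(G)` with `V e_J = e_{S J}`, then
`V∘Π(I)∘V⁻¹ = Π(S I)`; consequently the tracial state `τ(X) = ⟨e₀, X e₀⟩` is shift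
invariant: `τ(Π(S I)) = τ(Π(I))`. -/
theorem stmt8 (d : ℕ) (hd : 2 ≤ d)
    (A : ℤ → Matrix (Fin 2) (Fin 2) (ZMod d)) (hA0 : A 0 = 1) (hA : Consistent d A)
    (rep : (ℤ →₀ (ZMod d × ZMod d)) → (HS d →L[ℂ] HS d))
    (hrep : ∀ I J, rep I (eVec d J) = omegaMul d A I J • eVec d (I + J))
    (V : HS d ≃ₗᵢ[ℂ] HS d) (hV : ∀ J, V (eVec d J) = eVec d (Sg J)) :
    (∀ I x, V (rep I (V.symm x)) = rep (Sg I) x) ∧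
      ∀ I, ⟪eVec d 0, rep (Sg I) (eVec d 0)⟫_ℂ = ⟪eVec d 0, rep I (eVec d 0)⟫_ℂ := by
  have hc : ∀ I J, omegaMul d A (Sg I) (Sg J) = omegaMul d A I J := by
    intro I J
    rw [omegaMul, omegaMul, cExp_Sg]
  have key : ∀ I x, V (rep I x) = rep (Sg I) (V x) := by
    intro I x
    have := ext_eVec d ((V.toContinuousLinearEquiv : HS d →L[ℂ] HS d).comp (rep I))
      ((rep (Sg I)).comp (V.toContinuousLinearEquiv : HS d →L[ℂ] HS d)) (by
        intro J
        change V (rep I (eVec d J)) = rep (Sg I) (V (eVec d J))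
        rw [hrep, map_smul, hV, hV, hrep, hc, Sg_add'])
    exact congrArg (fun f : HS d →L[ℂ] HS d => f x) this
  refine ⟨fun I x => ?_, fun I => ?_⟩
  · rw [key, V.apply_symm_apply]
  · have h0 : V (eVec d 0) = eVec d 0 := by rw [hV, Sg_zero']
    rw [← V.inner_map_map (eVec d 0) (rep I (eVec d 0)), key, h0]
end
end

section
/- (Lemma 1) Suppose ⟨π(I)Ω, P₀(π(I)Ω)⟩ = 0 for every I ∈ G with I ≠ 0. Then the vector state is tracial on the twisted Weyl operators: ⟨Ω, π(I)Ω⟩ = 0 for every I ≠ 0, and ⟨Ω, π(I)(π(J)Ω)⟩ = ⟨Ω, π(J)(π(I)Ω)⟩ for all I, J ∈ G. -/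
open scoped BigOperators InnerProductSpace
open Filter Topology Finset

noncomputable section

/-- Lemma 1: If `⟨π(I)Ω, P₀(π(I)Ω)⟩ = 0` for every `I ≠ 0`, then the vector
state is tracial on the twisted Weyl operators: `⟨Ω, π(I)Ω⟩ = 0` for every `I ≠ 0`, and
`⟨Ω, π(I)π(J)Ω⟩ = ⟨Ω, π(J)π(I)Ω⟩` for all `I, J ∈ G`.  Here `U` is a unitary with
`UΩ = Ω` and `P₀` is the orthogonal projection onto the `U`-invariant subspace
(characterized by: `P₀ x` is `U`-invariant and `x − P₀ x` is orthogonal to all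
`U`-invariant vectors). -/
theorem stmt10 (d : ℕ) (hd : 2 ≤ d)
    (A : ℤ → Matrix (Fin 2) (Fin 2) (ZMod d)) (hA0 : A 0 = 1) (hA : Consistent d A)
    {H : Type*} [NormedAddCommGroup H] [InnerProductSpace ℂ H] [CompleteSpace H]
    (Ω : H) (hΩ : ‖Ω‖ = 1)
    (pr : (ℤ →₀ (ZMod d × ZMod d)) → (H →L[ℂ] H))
    (hu : ∀ I, pr I ∈ unitary (H →L[ℂ] H))
    (h1 : pr 0 = 1)
    (hmul : ∀ I J, pr I ∘L pr J = omegaMul d A I J • pr (I + J))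
    (U : H →L[ℂ] H) (hU : U ∈ unitary (H →L[ℂ] H)) (hUΩ : U Ω = Ω)
    (P₀ : H →L[ℂ] H)
    (hP₀fix : ∀ x, U (P₀ x) = P₀ x)
    (hP₀orth : ∀ x y, U y = y → ⟪x - P₀ x, y⟫_ℂ = 0)
    (h0 : ∀ I, I ≠ 0 → ⟪pr I Ω, P₀ (pr I Ω)⟫_ℂ = 0) :
    (∀ I, I ≠ 0 → ⟪Ω, pr I Ω⟫_ℂ = 0) ∧
      ∀ I J, ⟪Ω, pr I (pr J Ω)⟫_ℂ = ⟪Ω, pr J (pr I Ω)⟫_ℂ := by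
  have key : ∀ I, I ≠ 0 → ⟪Ω, pr I Ω⟫_ℂ = 0 := by
    intro I hI
    have e1 := hP₀orth (pr I Ω) (P₀ (pr I Ω)) (hP₀fix _)
    rw [inner_sub_left, h0 I hI, zero_sub, neg_eq_zero] at e1
    have e2 : P₀ (pr I Ω) = 0 := inner_self_eq_zero.mp e1
    have e3 := hP₀orth (pr I Ω) Ω hUΩ
    rw [e2, sub_zero] at e3
    exact inner_eq_zero_symm.mp e3
  have hm : ∀ I J x, pr I (pr J x) = omegaMul d A I J • pr (I + J) x := by
    intro I J x
    have := congrArg (fun T : H →L[ℂ] H => T x) (hmul I J)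
    simpa using this
  refine ⟨key, fun I J => ?_⟩
  by_cases hIJ : I + J = 0
  · have hJI : J + I = 0 := by rw [add_comm]; exact hIJ
    have hΩ0 : Ω ≠ 0 := by
      intro h
      simp [h] at hΩ
    have hne : pr I Ω ≠ 0 := by
      intro h
      have e := (Unitary.mem_iff.mp (hu I)).1
      have e' := congrArg (fun T : H →L[ℂ] H => T Ω) e
      simp [h] at e'
      exact hΩ0 e'.symm
    have a1 := hm I J (pr I Ω)
    rw [hm J I Ω, hIJ, hJI, h1] at a1
    simp only [map_smul, ContinuousLinearMap.one_apply] at a1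
    have a2 := smul_left_injective ℂ hne a1
    rw [hm I J, hm J I, hIJ, hJI, a2]
  · have hJI : J + I ≠ 0 := by rw [add_comm]; exact hIJ
    rw [hm I J, hm J I, inner_smul_right, inner_smul_right, key _ hIJ, key _ hJI]
    simp
end
end

section
/- (Lemma 2) For every I ∈ G, the limit lim_{N→∞} (1/N) Σ_{n=0}^{N−1} exp(−2πi·m_n/d) · ⟨Ω, π(I)(U^{−n}(π(I)* Ω))⟩ exists and equals ⟨π(I)Ω, P₀(π(I)Ω)⟩, where for each n, m_n ∈ ℤ is any integer representative of u_n(I) := B(I, Sⁿ I) ∈ ZMod d. -/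
open scoped BigOperators InnerProductSpace
open Filter Topology Finset

noncomputable section

theorem aux_c (d : ℕ) (A : ℤ → Matrix (Fin 2) (Fin 2) (ZMod d)) (hA0 : A 0 = 1)
    (hA : Consistent d A) (I J : ℤ →₀ (ZMod d × ZMod d)) :
    cExp d A I J = Bexp d A I J + cExp d A J I := by
  classical
  set T := I.support ∪ J.support with hT
  have hI : I.support ⊆ T := Finset.subset_union_left
  have hJ : J.support ⊆ T := Finset.subset_union_right
  have key : ∀ (F : ℤ → ℤ → ZMod d × ZMod d → ZMod d × ZMod d → ZMod d)
      (_ : ∀ a b l, F a b 0 l = 0) (_ : ∀ a b k, F a b k 0 = 0)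
      (K L : ℤ →₀ (ZMod d × ZMod d)) (_ : K.support ⊆ T) (_ : L.support ⊆ T),
      ∑ a ∈ K.support, ∑ b ∈ L.support, F a b (K a) (L b) =
        ∑ a ∈ T, ∑ b ∈ T, F a b (K a) (L b) := by
    intro F h1 h2 K L hK hL
    rw [Finset.sum_subset hK]
    · refine Finset.sum_congr rfl fun a _ => Finset.sum_subset hL ?_
      intro b _ hb
      rw [Finsupp.notMem_support_iff.1 hb, h2]
    · intro a _ ha
      rw [Finsupp.notMem_support_iff.1 ha]
      simp [h1]
  have key1 : ∀ (K L : ℤ →₀ (ZMod d × ZMod d)) (_ : K.support ⊆ T),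
      ∑ a ∈ K.support, (K a).1 * (L a).2 = ∑ a ∈ T, (K a).1 * (L a).2 := by
    intro K L hK
    refine Finset.sum_subset hK ?_
    intro a _ ha
    rw [Finsupp.notMem_support_iff.1 ha]; simp
  have z1 : ∀ (M : Matrix (Fin 2) (Fin 2) (ZMod d)) l, symp 0 (mvec M l) = 0 := by
    intros; simp [symp]
  have z2 : ∀ (M : Matrix (Fin 2) (Fin 2) (ZMod d)) k, symp k (mvec M 0) = 0 := by
    intros; simp [symp, mvec]
  have e1 := key (fun a b k l => if b < a then symp k (mvec (A (b - a)) l) else 0)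
    (by simp [z1]) (by simp [z2])
  have e2 := key (fun a b k l => symp k (mvec (A (b - a)) l)) (by simp [z1]) (by simp [z2])
  unfold cExp Bexp
  rw [e1 I J hI hJ, e1 J I hJ hI, e2 I J hI hJ, key1 I J hI, key1 J I hJ]
  rw [Finset.sum_comm (f := fun a b => if b < a then symp (J a) (mvec (A (b - a)) (I b)) else 0)]
  have diag : ∑ a ∈ T, ((I a).1 * (J a).2 - (J a).1 * (I a).2) =
      ∑ a ∈ T, ∑ b ∈ T, if b = a then symp (I a) (mvec (A (b - a)) (J b)) else 0 := by
    refine Finset.sum_congr rfl fun a ha => ?_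
    rw [Finset.sum_ite_eq' T a, if_pos ha]
    simp [hA0, symp, mvec]
    ring
  rw [Finset.sum_sub_distrib] at diag
  have main : ∑ a ∈ T, ∑ b ∈ T, symp (I a) (mvec (A (b - a)) (J b)) =
      (∑ a ∈ T, ∑ b ∈ T, if b < a then symp (I a) (mvec (A (b - a)) (J b)) else 0)
      + (∑ a ∈ T, ∑ b ∈ T, if b = a then symp (I a) (mvec (A (b - a)) (J b)) else 0)
      - (∑ a ∈ T, ∑ b ∈ T, if a < b then symp (J b) (mvec (A (a - b)) (I a)) else 0) := by
    rw [← Finset.sum_add_distrib, ← Finset.sum_sub_distrib]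
    refine Finset.sum_congr rfl fun a _ => ?_
    rw [← Finset.sum_add_distrib, ← Finset.sum_sub_distrib]
    refine Finset.sum_congr rfl fun b _ => ?_
    have h := hA (a - b) (I a) (J b)
    rw [neg_sub] at h
    rcases lt_trichotomy a b with hab | hab | hab
    · simp [hab, hab.not_gt, hab.ne', h]
    · simp [hab]
    · simp [hab, hab.not_gt, hab.ne]
  rw [main, ← diag]
  ring

theorem aux_exp (d : ℕ) [NeZero d] (j : ZMod d) :
    Complex.exp (2 * Real.pi * Complex.I * (j.val : ℂ) / d) = (ZMod.toCircle j : ℂ) :=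
  (ZMod.toCircle_apply j).symm

theorem aux_comm (d : ℕ) [NeZero d]
    (A : ℤ → Matrix (Fin 2) (Fin 2) (ZMod d)) (hA0 : A 0 = 1) (hA : Consistent d A)
    {H : Type*} [NormedAddCommGroup H] [InnerProductSpace ℂ H] [CompleteSpace H]
    (pr : (ℤ →₀ (ZMod d × ZMod d)) → (H →L[ℂ] H))
    (hu : ∀ I, pr I ∈ unitary (H →L[ℂ] H))
    (hmul : ∀ I J, pr I ∘L pr J = omegaMul d A I J • pr (I + J))
    (I K : ℤ →₀ (ZMod d × ZMod d)) (x : H) :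
    Complex.exp (-(2 * Real.pi * Complex.I * ((Bexp d A I K).val : ℂ) / d)) •
      pr K (ContinuousLinearMap.adjoint (pr I) x) =
      ContinuousLinearMap.adjoint (pr I) (pr K x) := by
  have hl : ∀ y, ContinuousLinearMap.adjoint (pr I) (pr I y) = y := fun y => by
    have := (Unitary.mem_iff.1 (hu I)).1
    exact congrArg (fun f : H →L[ℂ] H => f y) this
  have hr : ∀ y, pr I (ContinuousLinearMap.adjoint (pr I) y) = y := fun y => by
    have := (Unitary.mem_iff.1 (hu I)).2
    exact congrArg (fun f : H →L[ℂ] H => f y) this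
  have hc : ∀ y, pr I (pr K y) =
      Complex.exp (2 * Real.pi * Complex.I * ((Bexp d A I K).val : ℂ) / d) • pr K (pr I y) := by
    intro y
    have a1 := congrArg (fun f : H →L[ℂ] H => f y) (hmul I K)
    have a2 := congrArg (fun f : H →L[ℂ] H => f y) (hmul K I)
    simp only [ContinuousLinearMap.comp_apply, ContinuousLinearMap.smul_apply] at a1 a2
    rw [a1, a2, smul_smul, add_comm K I]
    congr 1
    unfold omegaMul
    rw [aux_exp, aux_exp, aux_exp, aux_c d A hA0 hA I K, AddChar.map_add_eq_mul, Circle.coe_mul]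
  have h2 := hc (ContinuousLinearMap.adjoint (pr I) x)
  rw [hr] at h2
  have h3 := congrArg (ContinuousLinearMap.adjoint (pr I)) h2
  rw [hl, map_smul] at h3
  rw [h3, smul_smul, ← Complex.exp_add]
  simp

/-- Lemma 2: For every `I ∈ G`, the averages
`(1/N) Σ_{n<N} exp(−2πi·u_n(I)/d)·⟨Ω, π(I)(U^{−n}(π(I)* Ω))⟩` converge to
`⟨π(I)Ω, P₀(π(I)Ω)⟩`, where `u_n(I) := B(I, Sⁿ I) ∈ ZMod d`. -/
theorem stmt11 (d : ℕ) (hd : 2 ≤ d)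
    (A : ℤ → Matrix (Fin 2) (Fin 2) (ZMod d)) (hA0 : A 0 = 1) (hA : Consistent d A)
    {H : Type*} [NormedAddCommGroup H] [InnerProductSpace ℂ H] [CompleteSpace H]
    (Ω : H) (hΩ : ‖Ω‖ = 1)
    (pr : (ℤ →₀ (ZMod d × ZMod d)) → (H →L[ℂ] H))
    (hu : ∀ I, pr I ∈ unitary (H →L[ℂ] H))
    (h1 : pr 0 = 1)
    (hmul : ∀ I J, pr I ∘L pr J = omegaMul d A I J • pr (I + J))
    (U : H ≃ₗᵢ[ℂ] H) (hUΩ : U Ω = Ω)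
    (hint : ∀ I x, U (pr I (U.symm x)) = pr (Sg I) x)
    (P₀ : H →L[ℂ] H)
    (hP₀fix : ∀ x, U (P₀ x) = P₀ x)
    (hP₀orth : ∀ x y, U y = y → ⟪x - P₀ x, y⟫_ℂ = 0) :
    ∀ I, Tendsto (fun N : ℕ => (N : ℂ)⁻¹ *
        ∑ n ∈ Finset.range N,
          Complex.exp (-(2 * Real.pi * Complex.I * ((Bexp d A I (Sg^[n] I)).val : ℂ) / d)) *
            ⟪Ω, pr I ((⇑U.symm)^[n] (ContinuousLinearMap.adjoint (pr I) Ω))⟫_ℂ)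
      atTop (𝓝 ⟪pr I Ω, P₀ (pr I Ω)⟫_ℂ) := by
  intro I
  haveI : NeZero d := ⟨by omega⟩
  have hiter : ∀ (n : ℕ) (x : H), (⇑U)^[n] (pr I ((⇑U.symm)^[n] x)) = pr (Sg^[n] I) x := by
    intro n
    induction n with
    | zero => intro x; rfl
    | succ n ih =>
      intro x
      rw [Function.iterate_succ_apply', Function.iterate_succ_apply, ih,
        Function.iterate_succ_apply', hint]
  have hUn : ∀ n : ℕ, (⇑U)^[n] Ω = Ω := fun n => Function.iterate_fixed hUΩ n
  have hUsn : ∀ n : ℕ, (⇑U.symm)^[n] Ω = Ω := fun n =>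
    Function.iterate_fixed (by rw [LinearIsometryEquiv.symm_apply_eq, hUΩ]) n
  have hin : ∀ (n : ℕ) (x y : H), ⟪(⇑U)^[n] x, (⇑U)^[n] y⟫_ℂ = ⟪x, y⟫_ℂ := by
    intro n
    induction n with
    | zero => intro x y; rfl
    | succ n ih =>
      intro x y
      rw [Function.iterate_succ_apply, Function.iterate_succ_apply, ih, U.inner_map_map]
  have hterm : ∀ n : ℕ,
      Complex.exp (-(2 * Real.pi * Complex.I * ((Bexp d A I (Sg^[n] I)).val : ℂ) / d)) *
            ⟪Ω, pr I ((⇑U.symm)^[n] (ContinuousLinearMap.adjoint (pr I) Ω))⟫_ℂ =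
        ⟪pr I Ω, (⇑U)^[n] (pr I Ω)⟫_ℂ := by
    intro n
    rw [← hin n, hUn, hiter, ← inner_smul_right, aux_comm d A hA0 hA pr hu hmul,
      ContinuousLinearMap.adjoint_inner_right, ← hiter n, hUsn]
  simp only [hterm]
  let f : H →L[ℂ] H := (U.toLinearIsometry).toContinuousLinearMap
  have hf : ‖f‖ ≤ 1 := U.toLinearIsometry.norm_toContinuousLinearMap_le
  have hfU : (⇑f) = ⇑U := rfl
  have ht := f.tendsto_birkhoffAverage_orthogonalProjection hf (pr I Ω)
  have hproj : (((f.eqLocus (1 : H →L[ℂ] H)).orthogonalProjectionOnto (pr I Ω) : _) : H)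
      = P₀ (pr I Ω) := by
    refine Submodule.eq_starProjection_of_mem_of_inner_eq_zero (K := f.eqLocus (1 : H →L[ℂ] H)) ?_ ?_
    · exact hP₀fix _
    · intro w hw
      exact hP₀orth _ _ hw
  rw [hproj] at ht
  have ht2 := (tendsto_const_nhds (x := pr I Ω)).inner (𝕜 := ℂ) ht
  refine ht2.congr fun N => ?_
  simp only [birkhoffAverage, birkhoffSum, inner_smul_right, inner_sum, hfU, id]
end
end

section
/- (Theorem 1) If x ∈ X is a typical point for a shift-invariant Borel probability measure μ on X, then for every finitely supported I : ℤ → (ZMod d)² the Fourier–Bohr spectrum of the sequence v(I) is contained in {0}: for every λ ∈ (0,1), lim_{N→∞} (1/N) Σ_{n=0}^{N−1} v_n(I)·exp(−2πi·n·λ) = 0; moreover the limit lim_{N→∞} (1/N) Σ_{n=0}^{N−1} v_n(I) exists. -/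
open scoped BigOperators InnerProductSpace
open Filter Topology Finset MeasureTheory

noncomputable section

/-- `ZMod d` carries the discrete topology. -/
instance (d : ℕ) : TopologicalSpace (ZMod d) := ⊥

instance (d : ℕ) : DiscreteTopology (ZMod d) := ⟨rfl⟩

/-- The space `X = ℤ → V` of two-sided sequences of `2×2` matrices over `ZMod d`, with the
product topology, carries the Borel σ-algebra. -/
instance (d : ℕ) : MeasurableSpace (ℤ → Matrix (Fin 2) (Fin 2) (ZMod d)) := borel _

/-- The shift `T` on `X = ℤ → V`: `(T y)(n) = y(n+1)`. -/
def Tsh {d : ℕ} (y : ℤ → Matrix (Fin 2) (Fin 2) (ZMod d)) :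
    ℤ → Matrix (Fin 2) (Fin 2) (ZMod d) := fun n => y (n + 1)

/-- A point `x ∈ X` is typical for `μ` if time averages of continuous functions along the
orbit of `x` reproduce the `μ`-averages, and the corresponding correlation averages exist
and are asymptotically mixing. -/
def Typical (d : ℕ) (μ : Measure (ℤ → Matrix (Fin 2) (Fin 2) (ZMod d)))
    (x : ℤ → Matrix (Fin 2) (Fin 2) (ZMod d)) : Prop :=
  (∀ f : (ℤ → Matrix (Fin 2) (Fin 2) (ZMod d)) → ℂ, Continuous f →
      Tendsto (fun N : ℕ => (N : ℂ)⁻¹ * ∑ n ∈ Finset.range N, f (Tsh^[n] x)) atTop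
        (𝓝 (∫ y, f y ∂μ))) ∧
    ∀ f g : (ℤ → Matrix (Fin 2) (Fin 2) (ZMod d)) → ℂ, Continuous f → Continuous g →
      ∃ c : ℕ → ℂ,
        (∀ k : ℕ, Tendsto (fun N : ℕ => (N : ℂ)⁻¹ *
            ∑ n ∈ Finset.range N, f (Tsh^[n] x) * g (Tsh^[n + k] x)) atTop (𝓝 (c k))) ∧
        Tendsto c atTop (𝓝 ((∫ y, f y ∂μ) * ∫ y, g y ∂μ))

/-- `u_n(I) = Σ_{a,b} σ(I(a), x(b+n−a)·I(b)) ∈ ZMod d`. -/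
def useq (d : ℕ) (x : ℤ → Matrix (Fin 2) (Fin 2) (ZMod d))
    (I : ℤ →₀ (ZMod d × ZMod d)) (n : ℕ) : ZMod d :=
  ∑ a ∈ I.support, ∑ b ∈ I.support, symp (I a) (mvec (x (b + (n : ℤ) - a)) (I b))

/-- `v_n(I) = exp(2πi·u_n(I)/d)`. -/
def vseq (d : ℕ) (x : ℤ → Matrix (Fin 2) (Fin 2) (ZMod d))
    (I : ℤ →₀ (ZMod d × ZMod d)) (n : ℕ) : ℂ :=
  Complex.exp (2 * Real.pi * Complex.I * ((useq d x I n).val : ℂ) / d)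

def av (z : ℕ → ℂ) (N : ℕ) : ℂ := (N : ℂ)⁻¹ * ∑ n ∈ Finset.range N, z n

lemma av_add (z w : ℕ → ℂ) (N : ℕ) : av (fun n => z n + w n) N = av z N + av w N := by
  simp [av, Finset.sum_add_distrib, mul_add]

lemma av_smul (c : ℂ) (z : ℕ → ℂ) (N : ℕ) : av (fun n => c * z n) N = c * av z N := by
  simp only [av, ← Finset.mul_sum]; ring

lemma av_sum {ι : Type*} (s : Finset ι) (z : ι → ℕ → ℂ) (N : ℕ) :
    av (fun n => ∑ i ∈ s, z i n) N = ∑ i ∈ s, av (z i) N := by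
  simp only [av, ← Finset.mul_sum]
  rw [Finset.sum_comm]

lemma inv_bdd_tendsto (u : ℕ → ℂ) (B : ℝ) (hB : ∀ n, ‖u n‖ ≤ B) :
    Tendsto (fun N : ℕ => (N : ℂ)⁻¹ * u N) atTop (𝓝 0) := by
  have h : Tendsto (fun N : ℕ => (N : ℝ)⁻¹ * B) atTop (𝓝 0) := by
    simpa using (tendsto_inv_atTop_nhds_zero_nat (𝕜 := ℝ)).mul_const B
  refine squeeze_zero_norm (fun N => ?_) h
  rw [norm_mul, norm_inv, Complex.norm_natCast]
  exact mul_le_mul_of_nonneg_left (hB N) (by positivity)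

lemma av_shift (z : ℕ → ℂ) (B : ℝ) (hB : ∀ n, ‖z n‖ ≤ B) (h : ℕ) :
    Tendsto (fun N => av (fun n => z (n + h)) N - av z N) atTop (𝓝 0) := by
  induction h with
  | zero => simp
  | succ h ih =>
    have h1 := inv_bdd_tendsto (fun N => z (N + h) - z (0 + h)) (B + B)
      (fun n => (norm_sub_le _ _).trans (add_le_add (hB _) (hB _)))
    have h2 := ih.add h1
    rw [add_zero] at h2
    refine h2.congr (fun N => ?_)
    have e1 := Finset.sum_range_succ (fun n => z (n + h)) N
    have e2 := Finset.sum_range_succ' (fun n => z (n + h)) N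
    have e3 : ∑ n ∈ Finset.range N, z (n + (h + 1)) = ∑ n ∈ Finset.range N, z (n + 1 + h) :=
      Finset.sum_congr rfl (fun n _ => by rw [add_assoc, add_comm 1 h])
    have e4 : ∑ n ∈ Finset.range N, z (n + 1 + h)
        = ∑ n ∈ Finset.range N, z (n + h) + z (N + h) - z (0 + h) := by
      rw [← e1, e2]; ring
    simp only [av, e3, e4]
    ring

lemma av_norm_sq (y : ℕ → ℂ) (N : ℕ) :
    ‖av y N‖ ^ 2 ≤ ‖av (fun n => y n * (starRingEnd ℂ) (y n)) N‖ := by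
  have e : ∀ n, y n * (starRingEnd ℂ) (y n) = ((‖y n‖ ^ 2 : ℝ) : ℂ) := by
    intro n
    rw [Complex.mul_conj, Complex.normSq_eq_norm_sq]
  simp only [av, e, ← Complex.ofReal_sum, norm_mul, norm_inv, Complex.norm_natCast,
    Complex.norm_real, Real.norm_eq_abs]
  rw [abs_of_nonneg (Finset.sum_nonneg (fun n _ => by positivity))]
  have h1 : ‖∑ n ∈ Finset.range N, y n‖ ^ 2 ≤ N * ∑ n ∈ Finset.range N, ‖y n‖ ^ 2 := by
    have h2 := sq_sum_le_card_mul_sum_sq (s := Finset.range N) (f := fun n => ‖y n‖)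
    rw [Finset.card_range] at h2
    refine le_trans ?_ h2
    gcongr
    exact norm_sum_le _ _
  rcases Nat.eq_zero_or_pos N with rfl | hN
  · simp
  have hN' : (0 : ℝ) < N := by exact_mod_cast hN
  calc ((N : ℝ)⁻¹ * ‖∑ n ∈ Finset.range N, y n‖) ^ 2
      = (N : ℝ)⁻¹ ^ 2 * ‖∑ n ∈ Finset.range N, y n‖ ^ 2 := by ring
    _ ≤ (N : ℝ)⁻¹ ^ 2 * (N * ∑ n ∈ Finset.range N, ‖y n‖ ^ 2) := by gcongr
    _ = _ := by field_simp

lemma corr_exists (z : ℕ → ℂ) (B : ℝ) (hB : ∀ n, ‖z n‖ ≤ B) (γ : ℕ → ℂ)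
    (hγ : ∀ k, Tendsto (av (fun n => z n * (starRingEnd ℂ) (z (n + k)))) atTop (𝓝 (γ k)))
    (p q : ℕ) (hpq : p ≤ q) :
    Tendsto (av (fun n => z (n + p) * (starRingEnd ℂ) (z (n + q)))) atTop (𝓝 (γ (q - p))) := by
  have hB0 : 0 ≤ B := (norm_nonneg _).trans (hB 0)
  have h := (av_shift (fun n => z n * (starRingEnd ℂ) (z (n + (q - p)))) (B * B)
    (fun n => by
      rw [norm_mul, RCLike.norm_conj]
      exact mul_le_mul (hB _) (hB _) (norm_nonneg _) hB0) p).add (hγ (q - p))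
  rw [zero_add] at h
  refine h.congr (fun N => ?_)
  rw [sub_add_cancel]
  congr 1
  funext n
  rw [show n + p + (q - p) = n + q by omega]

lemma av_conj (z : ℕ → ℂ) (N : ℕ) :
    av (fun n => (starRingEnd ℂ) (z n)) N = (starRingEnd ℂ) (av z N) := by
  simp [av]

lemma vdc (z : ℕ → ℂ) (B : ℝ) (hB : ∀ n, ‖z n‖ ≤ B) (γ : ℕ → ℂ)
    (hγ : ∀ k, Tendsto (av (fun n => z n * (starRingEnd ℂ) (z (n + k)))) atTop (𝓝 (γ k)))
    (h0 : Tendsto γ atTop (𝓝 0)) : Tendsto (av z) atTop (𝓝 0) := by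
  rw [Metric.tendsto_atTop]
  intro δ hδ
  simp only [dist_zero_right]
  obtain ⟨M, hM⟩ := (Metric.tendsto_atTop.1 h0) (δ ^ 2 / 8) (by positivity)
  simp only [dist_zero_right] at hM
  obtain ⟨K, hK⟩ := exists_nat_gt (‖γ 0‖ / (δ ^ 2 / 8))
  rw [div_lt_iff₀ (by positivity)] at hK
  have hK0 : (0 : ℝ) < K := by
    have := norm_nonneg (γ 0)
    by_contra hc
    have : (K : ℝ) * (δ ^ 2 / 8) ≤ 0 := mul_nonpos_of_nonpos_of_nonneg (not_lt.1 hc) (by positivity)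
    linarith
  have key : ∀ i j : ℕ, ∃ g : ℂ,
      Tendsto (av (fun n => z (n + i * M) * (starRingEnd ℂ) (z (n + j * M)))) atTop (𝓝 g) ∧
      ‖g‖ ≤ δ ^ 2 / 8 + if i = j then ‖γ 0‖ else 0 := by
    have main : ∀ i j : ℕ, i ≤ j → ‖γ (j * M - i * M)‖ ≤ δ ^ 2 / 8 + if i = j then ‖γ 0‖ else 0 := by
      intro i j hij
      rcases eq_or_lt_of_le hij with rfl | hlt
      · simp; positivity
      · rw [if_neg hlt.ne, add_zero]
        refine (hM _ ?_).le
        have : (i + 1) * M ≤ j * M := Nat.mul_le_mul_right _ hlt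
        rw [add_mul] at this
        show M ≤ _
        omega
    intro i j
    rcases le_total i j with hij | hij
    · exact ⟨_, corr_exists z B hB γ hγ _ _ (Nat.mul_le_mul_right M hij), main i j hij⟩
    · refine ⟨(starRingEnd ℂ) (γ (i * M - j * M)), ?_, ?_⟩
      · have h := corr_exists z B hB γ hγ _ _ (Nat.mul_le_mul_right M hij)
        have h' := (Complex.continuous_conj.tendsto _).comp h
        refine h'.congr (fun N => ?_)
        simp only [Function.comp]
        rw [← av_conj]
        congr 1
        funext n
        simp [mul_comm]
      · rw [RCLike.norm_conj]
        have := main j i hij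
        simpa only [eq_comm] using this
  choose g hg hgn using key
  set y : ℕ → ℂ := fun n => ∑ j ∈ Finset.range K, z (n + j * M) with hy
  have hG : Tendsto (av (fun n => y n * (starRingEnd ℂ) (y n))) atTop
      (𝓝 (∑ i ∈ Finset.range K, ∑ j ∈ Finset.range K, g i j)) := by
    have h := tendsto_finset_sum (Finset.range K) (fun i _ =>
      tendsto_finset_sum (Finset.range K) (fun j _ => hg i j))
    refine h.congr (fun N => ?_)
    simp only [← av_sum]
    congr 1
    funext n
    simp only [hy, map_sum, Finset.sum_mul_sum]
  have hGn : ‖∑ i ∈ Finset.range K, ∑ j ∈ Finset.range K, g i j‖ < (K * δ / 2) ^ 2 := by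
    calc _ ≤ ∑ i ∈ Finset.range K, ∑ j ∈ Finset.range K,
          (δ ^ 2 / 8 + if i = j then ‖γ 0‖ else 0) :=
          (norm_sum_le _ _).trans (Finset.sum_le_sum fun i _ =>
            (norm_sum_le _ _).trans (Finset.sum_le_sum fun j _ => hgn i j))
      _ = K * (K * (δ ^ 2 / 8)) + K * ‖γ 0‖ := by
          simp only [Finset.sum_add_distrib, Finset.sum_const, Finset.card_range, nsmul_eq_mul]
          congr 1
          rw [Finset.sum_congr rfl (g := fun _ => ‖γ 0‖)]
          · simp
          · intro i hi
            rw [Finset.sum_ite_eq, if_pos hi]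
      _ < K * (K * (δ ^ 2 / 8)) + K * (K * (δ ^ 2 / 8)) := by gcongr
      _ = _ := by ring
  have hD : Tendsto (fun N => av y N - K * av z N) atTop (𝓝 0) := by
    have h := tendsto_finset_sum (Finset.range K) (fun j _ => av_shift z B hB (j * M))
    rw [Finset.sum_const_zero] at h
    refine h.congr (fun N => ?_)
    rw [hy, av_sum, Finset.sum_sub_distrib]
    simp
  have ev1 := hG.norm.eventually (gt_mem_nhds hGn)
  have hD' := hD.norm
  rw [norm_zero] at hD'
  have ev2 := hD'.eventually (gt_mem_nhds (show (0 : ℝ) < K * δ / 2 by positivity))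
  obtain ⟨N0, hN0⟩ := Filter.eventually_atTop.1 (ev1.and ev2)
  refine ⟨N0, fun N hN => ?_⟩
  obtain ⟨a1, a2⟩ := hN0 N hN
  have b1 : ‖av y N‖ < K * δ / 2 :=
    lt_of_pow_lt_pow_left₀ 2 (by positivity) ((av_norm_sq y N).trans_lt a1)
  have b2 : ‖(K : ℂ) * av z N‖ < K * δ := by
    calc ‖(K : ℂ) * av z N‖ = ‖av y N - (av y N - K * av z N)‖ := by congr 1; ring
      _ ≤ ‖av y N‖ + ‖av y N - K * av z N‖ := norm_sub_le _ _
      _ < K * δ := by linarith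
  rw [norm_mul, Complex.norm_natCast] at b2
  exact lt_of_mul_lt_mul_left b2 hK0.le

lemma geom_av (r : ℂ) (hr : ‖r‖ = 1) (h1 : r ≠ 1) : Tendsto (av (fun n => r ^ n)) atTop (𝓝 0) := by
  refine inv_bdd_tendsto (fun N => ∑ n ∈ Finset.range N, r ^ n) (2 / ‖r - 1‖) (fun N => ?_)
  rw [geom_sum_eq h1, norm_div]
  gcongr
  calc ‖r ^ N - 1‖ ≤ ‖r ^ N‖ + ‖(1 : ℂ)‖ := norm_sub_le _ _
    _ = 2 := by simp [hr]; norm_num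

def Fobs (d : ℕ) (I : ℤ →₀ (ZMod d × ZMod d)) (y : ℤ → Matrix (Fin 2) (Fin 2) (ZMod d)) : ℂ :=
  Complex.exp (2 * Real.pi * Complex.I *
    ((∑ a ∈ I.support, ∑ b ∈ I.support, symp (I a) (mvec (y (b - a)) (I b)) : ZMod d).val : ℂ) / d)

lemma Fobs_cont (d : ℕ) (I : ℤ →₀ (ZMod d × ZMod d)) : Continuous (Fobs d I) := by
  have h : Continuous (fun y : ℤ → Matrix (Fin 2) (Fin 2) (ZMod d) =>
      (∑ a ∈ I.support, ∑ b ∈ I.support, symp (I a) (mvec (y (b - a)) (I b)) : ZMod d)) := by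
    refine continuous_finset_sum _ (fun a _ => continuous_finset_sum _ (fun b _ => ?_))
    have hc : Continuous (fun y : ℤ → Matrix (Fin 2) (Fin 2) (ZMod d) => y (b - a)) :=
      continuous_apply _
    have he : ∀ i j, Continuous (fun y : ℤ → Matrix (Fin 2) (Fin 2) (ZMod d) => y (b - a) i j) :=
      fun i j => hc.matrix_elem i j
    have h00 := he 0 0
    have h01 := he 0 1
    have h10 := he 1 0
    have h11 := he 1 1
    simp only [symp, mvec]
    fun_prop
  exact (continuous_of_discreteTopology (f := fun u : ZMod d =>
    Complex.exp (2 * Real.pi * Complex.I * (u.val : ℂ) / d))).comp h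

lemma Fobs_norm (d : ℕ) (I : ℤ →₀ (ZMod d × ZMod d)) (y) : ‖Fobs d I y‖ = 1 := by
  unfold Fobs
  generalize (ZMod.val _) = m
  rw [show (2 * Real.pi * Complex.I * (m : ℂ) / d : ℂ) = ((2 * Real.pi * m / d : ℝ) : ℂ) * Complex.I by
    push_cast; ring]
  exact Complex.norm_exp_ofReal_mul_I _

lemma Tsh_iter {d : ℕ} (x : ℤ → Matrix (Fin 2) (Fin 2) (ZMod d)) (n : ℕ) (m : ℤ) :
    (Tsh^[n] x) m = x (m + n) := by
  induction n generalizing m with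
  | zero => simp
  | succ n ih =>
    rw [Function.iterate_succ_apply']
    simp only [Tsh, ih]
    congr 1
    push_cast; ring

lemma Fobs_orbit (d : ℕ) (x : ℤ → Matrix (Fin 2) (Fin 2) (ZMod d)) (I : ℤ →₀ (ZMod d × ZMod d))
    (n : ℕ) : vseq d x I n = Fobs d I (Tsh^[n] x) := by
  simp only [vseq, useq, Fobs, Tsh_iter, sub_add_eq_add_sub]

/-- Theorem 1: If `x ∈ X` is a typical point for a shift-invariant Borel
probability measure `μ` on `X`, then for every finitely supported `I : ℤ → (ZMod d)²` the
Fourier–Bohr spectrum of the sequence `v(I)` is contained in `{0}`: for every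
`λ ∈ (0,1)`, `(1/N) Σ_{n<N} v_n(I)·exp(−2πi·n·λ) → 0`; moreover the Cesàro limit of
`v(I)` exists. -/
theorem stmt13 (d : ℕ) (hd : 2 ≤ d)
    (μ : Measure (ℤ → Matrix (Fin 2) (Fin 2) (ZMod d))) [IsProbabilityMeasure μ]
    (hinv : MeasurePreserving (Tsh (d := d)) μ μ)
    (x : ℤ → Matrix (Fin 2) (Fin 2) (ZMod d)) (hx : Typical d μ x) :
    ∀ I : ℤ →₀ (ZMod d × ZMod d),
      (∀ lam : ℝ, 0 < lam → lam < 1 →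
        Tendsto (fun N : ℕ => (N : ℂ)⁻¹ * ∑ n ∈ Finset.range N,
            vseq d x I n * Complex.exp (-(2 * Real.pi * Complex.I * n * lam)))
          atTop (𝓝 0)) ∧
      ∃ L : ℂ, Tendsto (fun N : ℕ => (N : ℂ)⁻¹ * ∑ n ∈ Finset.range N, vseq d x I n)
        atTop (𝓝 L) := by
  intro I
  have hFc := Fobs_cont d I
  haveI : BorelSpace (ℤ → Matrix (Fin 2) (Fin 2) (ZMod d)) := ⟨rfl⟩
  have hFi : Integrable (Fobs d I) μ :=
    Integrable.of_bound hFc.aestronglyMeasurable 1 (ae_of_all _ fun y => (Fobs_norm d I y).le)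
  set m : ℂ := ∫ y, Fobs d I y ∂μ with hm
  refine ⟨?_, m, ?_⟩
  swap
  · simpa only [Fobs_orbit] using hx.1 _ hFc
  intro lam hl0 hl1
  set r : ℂ := Complex.exp (-(2 * Real.pi * Complex.I * lam)) with hr
  have hrn : ‖r‖ = 1 := by
    rw [hr, show (-(2 * Real.pi * Complex.I * lam) : ℂ)
      = ((-(2 * Real.pi * lam) : ℝ) : ℂ) * Complex.I by push_cast; ring]
    exact Complex.norm_exp_ofReal_mul_I _
  have hr1 : r ≠ 1 := by
    intro h
    obtain ⟨n, hn⟩ := Complex.exp_eq_one_iff.1 h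
    have h2 : (-lam : ℂ) = n := by
      apply mul_right_cancel₀ Complex.two_pi_I_ne_zero
      rw [← hn]; ring
    have h3 : -lam = (n : ℝ) := by exact_mod_cast h2
    have h4 : (n : ℝ) < 0 := by linarith
    have h5 : (-1 : ℝ) < n := by linarith
    have h6 : n < 0 := by exact_mod_cast h4
    have h7 : -1 < n := by exact_mod_cast h5
    omega
  have hrc : r * (starRingEnd ℂ) r = 1 := by
    rw [Complex.mul_conj, Complex.normSq_eq_norm_sq, hrn]; simp
  set f : (ℤ → Matrix (Fin 2) (Fin 2) (ZMod d)) → ℂ := fun y => Fobs d I y - m with hf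
  have hfc : Continuous f := hFc.sub continuous_const
  have hf0 : ∫ y, f y ∂μ = 0 := by
    rw [hf, integral_sub hFi (integrable_const m)]
    simp [hm]
  obtain ⟨c, hc, hc0⟩ := hx.2 f (fun y => (starRingEnd ℂ) (f y)) hfc
    (Complex.continuous_conj.comp hfc)
  rw [hf0, zero_mul] at hc0
  have hz := vdc (fun n => f (Tsh^[n] x) * r ^ n) (1 + ‖m‖) (fun n => by
      rw [norm_mul, norm_pow, hrn, one_pow, mul_one]
      refine (norm_sub_le _ _).trans ?_
      rw [Fobs_norm])
    (fun k => (starRingEnd ℂ) r ^ k * c k)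
    (fun k => by
      refine ((hc k).const_mul ((starRingEnd ℂ) r ^ k)).congr (fun N => ?_)
      change _ * av _ N = _
      rw [← av_smul]
      congr 1
      funext n
      have : r ^ n * (starRingEnd ℂ) r ^ n = 1 := by rw [← mul_pow, hrc, one_pow]
      simp only [map_mul, map_pow, pow_add]
      linear_combination (-(starRingEnd ℂ) r ^ k * f (Tsh^[n] x) *
        (starRingEnd ℂ) (f (Tsh^[n + k] x))) * this)
    (by
      refine squeeze_zero_norm (fun k => ?_) (by simpa using hc0.norm)
      rw [norm_mul, norm_pow, RCLike.norm_conj, hrn, one_pow, one_mul])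
  have hfin := hz.add ((geom_av r hrn hr1).const_mul m)
  rw [mul_zero, add_zero] at hfin
  refine hfin.congr (fun N => ?_)
  rw [← av_smul, ← av_add]
  unfold av
  congr 1
  refine Finset.sum_congr rfl (fun n _ => ?_)
  have : Complex.exp (-(2 * Real.pi * Complex.I * n * lam)) = r ^ n := by
    rw [hr, ← Complex.exp_nat_mul]
    congr 1; ring
  rw [this, Fobs_orbit, hf]
  ring
end
end

section
/- Let v : ℕ → ℂ satisfy |v_n| ≤ 1 for all n. Suppose that for every k ≥ 1 the autocorrelation s_k := lim_{N→∞} (1/N) Σ_{n=0}^{N−1} conj(v_n)·v_{n+k} exists, and s_k → L as k → ∞ for some L ∈ ℂ. Then for every real λ with λ ∉ ℤ, lim_{N→∞} (1/N) Σ_{n=0}^{N−1} v_n·exp(−2πi·n·λ) = 0; that is, the Fourier–Bohr spectrum of v is contained in {0}. -/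
open scoped BigOperators
open Filter Topology

noncomputable section

def avgA (f : ℕ → ℂ) (N : ℕ) : ℂ := (N : ℂ)⁻¹ * ∑ n ∈ Finset.range N, f n

lemma avgA_sum {ι : Type*} (s : Finset ι) (f : ι → ℕ → ℂ) (N : ℕ) :
    avgA (fun n => ∑ i ∈ s, f i n) N = ∑ i ∈ s, avgA (f i) N := by
  unfold avgA
  rw [Finset.sum_comm, Finset.mul_sum]

lemma avgA_norm_le (f : ℕ → ℂ) (C : ℝ) (hC : 0 ≤ C) (hf : ∀ n, ‖f n‖ ≤ C) (N : ℕ) :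
    ‖avgA f N‖ ≤ C := by
  unfold avgA
  rcases Nat.eq_zero_or_pos N with rfl | hN
  · simpa using hC
  have hN' : (0:ℝ) < N := by exact_mod_cast hN
  rw [norm_mul, norm_inv, Complex.norm_natCast, inv_mul_le_iff₀ hN']
  calc _ ≤ ∑ n ∈ Finset.range N, ‖f n‖ := norm_sum_le _ _
    _ ≤ ∑ n ∈ Finset.range N, C := Finset.sum_le_sum fun i _ => hf i
    _ = _ := by simp

lemma avgA_shift (f : ℕ → ℂ) (C : ℝ) (hf : ∀ n, ‖f n‖ ≤ C) (m : ℕ) :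
    Tendsto (fun N => avgA (fun n => f (n + m)) N - avgA f N) atTop (𝓝 0) := by
  have hC : 0 ≤ C := (norm_nonneg _).trans (hf 0)
  have key : ∀ N, ‖avgA (fun n => f (n + m)) N - avgA f N‖ ≤ (2 * m * C) * (N : ℝ)⁻¹ := by
    intro N
    have h1 : ∑ n ∈ Finset.range N, f (n + m) - ∑ n ∈ Finset.range N, f n
        = ∑ n ∈ Finset.range m, f (N + n) - ∑ n ∈ Finset.range m, f n := by
      have a := Finset.sum_range_add f N m
      have b := Finset.sum_range_add f m N
      rw [add_comm m N] at b
      simp_rw [add_comm m] at b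
      linear_combination a - b
    unfold avgA
    rw [← mul_sub, h1, norm_mul, norm_inv, Complex.norm_natCast, mul_comm]
    gcongr
    calc _ ≤ ‖∑ n ∈ Finset.range m, f (N + n)‖ + ‖∑ n ∈ Finset.range m, f n‖ := norm_sub_le _ _
      _ ≤ ∑ n ∈ Finset.range m, C + ∑ n ∈ Finset.range m, C :=
        add_le_add (norm_sum_le_of_le _ fun i _ => hf _) (norm_sum_le_of_le _ fun i _ => hf _)
      _ = _ := by simp; ring
  refine squeeze_zero_norm key ?_
  simpa using (tendsto_inv_atTop_nhds_zero_nat (𝕜 := ℝ)).const_mul (2 * m * C)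

lemma avgA_cs (f : ℕ → ℂ) (N : ℕ) :
    ‖avgA f N‖ ^ 2 ≤ ‖avgA (fun n => (starRingEnd ℂ) (f n) * f n) N‖ := by
  unfold avgA
  rcases Nat.eq_zero_or_pos N with rfl | hN
  · simp
  have hN' : (0:ℝ) < N := by exact_mod_cast hN
  have e : ∑ n ∈ Finset.range N, (starRingEnd ℂ) (f n) * f n
      = ((∑ n ∈ Finset.range N, ‖f n‖ ^ 2 : ℝ) : ℂ) := by
    push_cast
    refine Finset.sum_congr rfl fun n _ => ?_
    rw [mul_comm, Complex.mul_conj']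
  rw [e, norm_mul, norm_mul, norm_inv, Complex.norm_natCast, Complex.norm_real,
    Real.norm_of_nonneg (Finset.sum_nonneg fun _ _ => sq_nonneg _), mul_pow]
  have h1 : ‖∑ n ∈ Finset.range N, f n‖ ^ 2 ≤ N * ∑ n ∈ Finset.range N, ‖f n‖ ^ 2 := by
    calc _ ≤ (∑ n ∈ Finset.range N, ‖f n‖) ^ 2 := by gcongr; exact norm_sum_le _ _
      _ ≤ _ := by simpa using sq_sum_le_card_mul_sum_sq (s := Finset.range N) (f := fun n => ‖f n‖)
  calc _ ≤ ((N:ℝ)⁻¹) ^ 2 * (N * ∑ n ∈ Finset.range N, ‖f n‖ ^ 2) := by gcongr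
    _ = _ := by field_simp

lemma vdc_s15 (u : ℕ → ℂ) (C : ℝ) (hu : ∀ n, ‖u n‖ ≤ C)
    (h : ∀ ε > 0, ∃ K : ℕ, ∀ k ≥ K, ∀ᶠ N in atTop,
      ‖avgA (fun n => (starRingEnd ℂ) (u n) * u (n + k)) N‖ < ε) :
    Tendsto (avgA u) atTop (𝓝 0) := by
  have hC : 0 ≤ C := (norm_nonneg _).trans (hu 0)
  rw [Metric.tendsto_nhds]
  intro δ hδ
  obtain ⟨K, hK⟩ := h (δ ^ 2 / 16) (by positivity)
  obtain ⟨H, hH⟩ := exists_nat_gt (max 1 (8 * C ^ 2 / δ ^ 2))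
  have hH1 : (1:ℝ) < H := (le_max_left _ _).trans_lt hH
  have hH2 : 8 * C ^ 2 ≤ H * δ ^ 2 := by
    have := ((le_max_right _ _).trans_lt hH).le
    rwa [div_le_iff₀ (by positivity)] at this
  have hbd : ∀ i j n, ‖(starRingEnd ℂ) (u (n + i)) * u (n + j)‖ ≤ C * C := by
    intro i j n
    rw [norm_mul, RCLike.norm_conj]
    exact mul_le_mul (hu _) (hu _) (norm_nonneg _) hC
  -- off-diagonal correlations
  have off1 : ∀ i j : ℕ, i < j → ∀ᶠ N in atTop,
      ‖avgA (fun n => (starRingEnd ℂ) (u (n + i * K)) * u (n + j * K)) N‖ < δ ^ 2 / 8 := by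
    intro i j hij
    have hle : i * K ≤ j * K := Nat.mul_le_mul_right _ hij.le
    have hk : (j * K - i * K) ≥ K := by
      rw [← Nat.sub_mul]; exact Nat.le_mul_of_pos_left _ (by omega)
    have h1 := hK _ hk
    have h2 := avgA_shift (fun n => (starRingEnd ℂ) (u n) * u (n + (j * K - i * K))) (C * C)
      (fun n => by simpa using hbd 0 (j * K - i * K) n) (i * K)
    have h3 := (Metric.tendsto_nhds.1 h2) (δ ^ 2 / 16) (by positivity)
    filter_upwards [h1, h3] with N a b
    have e : ∀ n, n + i * K + (j * K - i * K) = n + j * K := by intro n; omega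
    simp only [e, dist_zero_right] at b
    have := norm_add_le
      (avgA (fun n => (starRingEnd ℂ) (u (n + i * K)) * u (n + j * K)) N -
        avgA (fun n => (starRingEnd ℂ) (u n) * u (n + (j * K - i * K))) N)
      (avgA (fun n => (starRingEnd ℂ) (u n) * u (n + (j * K - i * K))) N)
    rw [sub_add_cancel] at this
    linarith
  have off : ∀ i j : ℕ, ∀ᶠ N in atTop,
      ‖avgA (fun n => (starRingEnd ℂ) (u (n + i * K)) * u (n + j * K)) N‖
        ≤ (if i = j then C * C else 0) + δ ^ 2 / 8 := by
    intro i j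
    rcases lt_trichotomy i j with hij | rfl | hij
    · filter_upwards [off1 i j hij] with N a
      rw [if_neg hij.ne]; linarith
    · refine Eventually.of_forall fun N => ?_
      rw [if_pos rfl]
      have := avgA_norm_le _ (C * C) (by positivity) (hbd (i * K) (i * K)) N
      have : 0 < δ ^ 2 / 8 := by positivity
      linarith
    · filter_upwards [off1 j i hij] with N a
      rw [if_neg hij.ne']
      have e : avgA (fun n => (starRingEnd ℂ) (u (n + i * K)) * u (n + j * K)) N =
          (starRingEnd ℂ) (avgA (fun n => (starRingEnd ℂ) (u (n + j * K)) * u (n + i * K)) N) := by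
        simp [avgA, mul_comm]
      rw [e, RCLike.norm_conj]; linarith
  have offall : ∀ᶠ N in atTop, ∀ i ∈ Finset.range H, ∀ j ∈ Finset.range H,
      ‖avgA (fun n => (starRingEnd ℂ) (u (n + i * K)) * u (n + j * K)) N‖
        ≤ (if i = j then C * C else 0) + δ ^ 2 / 8 := by
    rw [Filter.eventually_all_finset]
    intro i _
    rw [Filter.eventually_all_finset]
    intro j _
    exact off i j
  have hshift : Tendsto (fun N => ∑ i ∈ Finset.range H,
      (avgA (fun n => u (n + i * K)) N - avgA u N)) atTop (𝓝 0) := by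
    simpa using tendsto_finsetSum (Finset.range H) fun i _ => avgA_shift u C hu (i * K)
  have hs2 := (Metric.tendsto_nhds.1 hshift) (H * δ / 2) (by positivity)
  filter_upwards [offall, hs2] with N a b
  rw [dist_zero_right] at b ⊢
  rw [Finset.sum_sub_distrib, ← avgA_sum, Finset.sum_const, Finset.card_range, nsmul_eq_mul] at b
  have hcs := avgA_cs (fun n => ∑ i ∈ Finset.range H, u (n + i * K)) N
  have e : avgA (fun n => (starRingEnd ℂ) (∑ i ∈ Finset.range H, u (n + i * K)) *
      ∑ i ∈ Finset.range H, u (n + i * K)) N = ∑ i ∈ Finset.range H, ∑ j ∈ Finset.range H,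
        avgA (fun n => (starRingEnd ℂ) (u (n + i * K)) * u (n + j * K)) N := by
    simp_rw [← avgA_sum, map_sum, Finset.sum_mul_sum]
  rw [e] at hcs
  have hb : ‖∑ i ∈ Finset.range H, ∑ j ∈ Finset.range H,
        avgA (fun n => (starRingEnd ℂ) (u (n + i * K)) * u (n + j * K)) N‖ ≤
        H * (C * C) + H * (H * (δ ^ 2 / 8)) := by
    calc _ ≤ ∑ i ∈ Finset.range H, ∑ j ∈ Finset.range H,
          ((if i = j then C * C else 0) + δ ^ 2 / 8) :=
          norm_sum_le_of_le _ fun i hi => norm_sum_le_of_le _ fun j hj => a i hi j hj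
      _ = ∑ i ∈ Finset.range H, (C * C + H * (δ ^ 2 / 8)) := by
          refine Finset.sum_congr rfl fun i hi => ?_
          rw [Finset.sum_add_distrib, Finset.sum_ite_eq, if_pos hi]
          simp
      _ = _ := by simp
  set G := avgA (fun n => ∑ i ∈ Finset.range H, u (n + i * K)) N
  have hG : ‖G‖ ≤ H * δ / 2 := by
    refine abs_le_of_sq_le_sq' ?_ (by positivity) |>.2
    nlinarith
  have h3 : ‖(H:ℂ) * avgA u N‖ ≤ ‖G‖ + ‖G - H * avgA u N‖ := by
    have := norm_sub_le G (G - H * avgA u N)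
    rwa [sub_sub_cancel] at this
  rw [norm_mul, Complex.norm_natCast] at h3
  have : (H:ℝ) * ‖avgA u N‖ < H * δ := by linarith
  exact lt_of_mul_lt_mul_left this (by positivity)

/-- Let `v : ℕ → ℂ` with `|v_n| ≤ 1`.  If for every `k ≥ 1` the
autocorrelation `s_k = lim_N (1/N) Σ_{n<N} conj(v_n)·v_{n+k}` exists and `s_k → L` as
`k → ∞`, then for every real `λ ∉ ℤ` one has
`(1/N) Σ_{n<N} v_n·exp(−2πi·n·λ) → 0`; that is, the Fourier–Bohr spectrum of `v` is
contained in `{0}`. -/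
theorem stmt15 (v : ℕ → ℂ) (hv : ∀ n, ‖v n‖ ≤ 1)
    (s : ℕ → ℂ)
    (hs : ∀ k, 1 ≤ k →
      Tendsto (fun N : ℕ => (N : ℂ)⁻¹ *
          ∑ n ∈ Finset.range N, (starRingEnd ℂ) (v n) * v (n + k))
        atTop (𝓝 (s k)))
    (L : ℂ) (hL : Tendsto s atTop (𝓝 L)) :
    ∀ lam : ℝ, (∀ m : ℤ, lam ≠ (m : ℝ)) →
      Tendsto (fun N : ℕ => (N : ℂ)⁻¹ *
          ∑ n ∈ Finset.range N, v n * Complex.exp (-(2 * Real.pi * Complex.I * n * lam)))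
        atTop (𝓝 0) := by
  intro lam hlam
  obtain ⟨z, hz⟩ : ∃ z, z = Complex.exp (-(2 * Real.pi * Complex.I * lam)) := ⟨_, rfl⟩
  have hz1 : ‖z‖ = 1 := by
    have : -(2 * Real.pi * Complex.I * lam) = ((-(2 * Real.pi * lam) : ℝ) : ℂ) * Complex.I := by
      push_cast; ring
    rw [hz, this, Complex.norm_exp_ofReal_mul_I]
  have hzne : z ≠ 1 := by
    intro h
    rw [hz, Complex.exp_eq_one_iff] at h
    obtain ⟨n, hn⟩ := h
    apply hlam (-n)
    have h2 : (2 * Real.pi * Complex.I : ℂ) ≠ 0 := Complex.two_pi_I_ne_zero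
    have : (2 * Real.pi * Complex.I : ℂ) * lam = 2 * Real.pi * Complex.I * ((-n : ℤ) : ℂ) := by
      push_cast; linear_combination -hn
    exact_mod_cast mul_left_cancel₀ h2 this
  have hexp : ∀ n : ℕ, Complex.exp (-(2 * Real.pi * Complex.I * n * lam)) = z ^ n := by
    intro n
    rw [hz, ← Complex.exp_nat_mul]; congr 1; ring
  simp_rw [hexp]
  change Tendsto (avgA fun n => v n * z ^ n) atTop (𝓝 0)
  have hzz : ∀ n : ℕ, (starRingEnd ℂ) (z ^ n) * z ^ n = 1 := by
    intro n
    rw [mul_comm, Complex.mul_conj', norm_pow, hz1]; simp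
  have hF : ∀ k n, ‖(starRingEnd ℂ) (v n) * v (n + k)‖ ≤ 1 := by
    intro k n
    rw [norm_mul, RCLike.norm_conj]
    exact mul_le_one₀ (hv _) (norm_nonneg _) (hv _)
  have hs' : ∀ k, 1 ≤ k → Tendsto (avgA fun n => (starRingEnd ℂ) (v (n + 1)) * v (n + 1 + k))
      atTop (𝓝 (s k)) := by
    intro k hk
    have := (avgA_shift _ 1 (hF k) 1).add (hs k hk)
    rw [zero_add] at this
    refine this.congr fun N => ?_
    exact sub_add_cancel _ _
  have hu := vdc_s15 (fun n => (v (n + 1) - v n) * z ^ n) 2 (by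
    intro n
    rw [norm_mul, norm_pow, hz1, one_pow, mul_one]
    have := norm_sub_le (v (n + 1)) (v n)
    linarith [hv (n + 1), hv n]) (by
    intro ε hε
    have hd : Tendsto (fun j => s (j + 1) + s (j + 1) - s (j + 2) - s j) atTop (𝓝 0) := by
      have h1 := (tendsto_add_atTop_iff_nat 1).2 hL
      have h2 := (tendsto_add_atTop_iff_nat 2).2 hL
      have := ((h1.add h1).sub h2).sub hL
      simpa using this
    obtain ⟨J, hJ⟩ := eventually_atTop.1 (Metric.tendsto_nhds.1 hd ε hε)
    refine ⟨J + 2, fun k hk => ?_⟩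
    obtain ⟨j, rfl⟩ : ∃ j, k = j + 1 := ⟨k - 1, by omega⟩
    have hj := hJ j (by omega)
    rw [dist_zero_right] at hj
    have hlim := (((hs' (j + 1) (by omega)).add (hs (j + 1) (by omega))).sub
      (hs (j + 2) (by omega))).sub (hs' j (by omega))
    filter_upwards [hlim.norm.eventually_lt_const hj] with N hN
    have e : avgA (fun n => (starRingEnd ℂ) ((v (n + 1) - v n) * z ^ n) *
        ((v (n + (j + 1) + 1) - v (n + (j + 1))) * z ^ (n + (j + 1)))) N =
        z ^ (j + 1) * (avgA (fun n => (starRingEnd ℂ) (v (n + 1)) * v (n + 1 + (j + 1))) N +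
          avgA (fun n => (starRingEnd ℂ) (v n) * v (n + (j + 1))) N -
          avgA (fun n => (starRingEnd ℂ) (v n) * v (n + (j + 2))) N -
          avgA (fun n => (starRingEnd ℂ) (v (n + 1)) * v (n + 1 + j)) N) := by
      unfold avgA
      rw [← mul_add, ← mul_sub, ← mul_sub, ← Finset.sum_add_distrib, ← Finset.sum_sub_distrib,
        ← Finset.sum_sub_distrib, mul_left_comm, Finset.mul_sum _ _ (z ^ (j + 1))]
      congr 1
      refine Finset.sum_congr rfl fun n _ => ?_
      have e1 : n + (j + 1) + 1 = n + (j + 2) := by ring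
      have e2 : n + 1 + (j + 1) = n + (j + 2) := by ring
      have e3 : n + 1 + j = n + (j + 1) := by ring
      beta_reduce
      rw [e1, e2, e3, pow_add z n, map_mul, map_sub]
      linear_combination (z ^ (j + 1) * ((starRingEnd ℂ) (v (n + 1)) - (starRingEnd ℂ) (v n)) *
        (v (n + (j + 2)) - v (n + (j + 1)))) * hzz n
    rw [e, norm_mul, norm_pow, hz1, one_pow, one_mul]
    exact hN)
  have hw := avgA_shift (fun n => v n * z ^ n) 1 (by
    intro n
    rw [norm_mul, norm_pow, hz1, one_pow, mul_one]; exact hv n) 1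
  have hfin := ((hu.const_mul z).sub hw).const_mul ((1 - z)⁻¹)
  simp only [mul_zero, sub_zero] at hfin
  refine hfin.congr fun N => ?_
  have hne : (1 - z) ≠ 0 := sub_ne_zero.2 hzne.symm
  rw [inv_mul_eq_iff_eq_mul₀ hne]
  unfold avgA
  have e : z * ∑ n ∈ Finset.range N, (v (n + 1) - v n) * z ^ n =
      ∑ n ∈ Finset.range N, v (n + 1) * z ^ (n + 1) - z * ∑ n ∈ Finset.range N, v n * z ^ n := by
    rw [Finset.mul_sum, Finset.mul_sum, ← Finset.sum_sub_distrib]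
    exact Finset.sum_congr rfl fun n _ => by ring
  linear_combination (N : ℂ)⁻¹ * e
end
end

section
/- Let v : ℕ → ℂ be bounded and let (N_j)_{j∈ℕ} be a strictly increasing sequence of positive integers such that for every k ∈ ℕ the limit s_k := lim_{j→∞} (1/N_j) Σ_{n=0}^{N_j−1} conj(v_n)·v_{n+k} exists. Extend s to ℤ by s_{−k} := conj(s_k). Then the sequence (s_k)_{k∈ℤ} is positive definite: for every finitely supported z : ℤ → ℂ, the number Σ_{i,j∈ℤ} conj(z_i)·s_{i−j}·z_j is real and nonnegative. -/
open scoped BigOperators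
open Filter Topology

noncomputable section

lemma avg_shift (N : ℕ → ℕ) (hN : StrictMono N) (b : ℕ) :
    ∀ (f : ℕ → ℂ) (D : ℝ) (_ : ∀ n, ‖f n‖ ≤ D) (L : ℂ)
    (_ : Tendsto (fun j : ℕ => ((N j : ℂ))⁻¹ * ∑ n ∈ Finset.range (N j), f n) atTop (𝓝 L)),
    Tendsto (fun j : ℕ => ((N j : ℂ))⁻¹ * ∑ n ∈ Finset.range (N j), f (n + b)) atTop (𝓝 L) := by
  induction b with
  | zero => intro f D _ L h; simpa using h
  | succ b ih =>
    intro f D hf L h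
    have key := ih (fun n => f (n + 1)) D (fun n => hf _) L ?_
    · refine key.congr (fun j => ?_)
      congr 1
    · have h0 : Tendsto (fun j : ℕ => ((N j : ℂ))⁻¹ * (f (N j) - f 0)) atTop (𝓝 0) := by
        have h1 : Tendsto (fun j : ℕ => ((N j : ℝ))⁻¹ * (D + D)) atTop (𝓝 0) := by
          have := (tendsto_inv_atTop_zero.comp
            ((tendsto_natCast_atTop_atTop (R := ℝ)).comp hN.tendsto_atTop)).mul_const (D + D)
          simpa using this
        refine squeeze_zero_norm (fun j => ?_) h1
        rw [norm_mul, norm_inv, Complex.norm_natCast]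
        gcongr
        exact (norm_sub_le _ _).trans (add_le_add (hf _) (hf _))
      have h2 := h.add h0
      rw [add_zero] at h2
      refine h2.congr (fun j => ?_)
      rw [← mul_add]
      congr 1
      have e1 := Finset.sum_range_succ f (N j)
      have e2 := Finset.sum_range_succ' f (N j)
      rw [e1] at e2
      linear_combination e2

/-- Let `v : ℕ → ℂ` be bounded and `(N_j)` strictly increasing positive
integers such that `s_k = lim_j (1/N_j) Σ_{n<N_j} conj(v_n)·v_{n+k}` exists for every
`k ∈ ℕ`; extend `s` to `ℤ` by `s_{−k} = conj(s_k)`.  Then `(s_k)_{k∈ℤ}` is positive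
definite: for every finitely supported `z : ℤ → ℂ`, the number
`Σ_{i,j} conj(z_i)·s_{i−j}·z_j` is real and nonnegative. -/
theorem stmt17 (v : ℕ → ℂ) (C : ℝ) (hv : ∀ n, ‖v n‖ ≤ C)
    (N : ℕ → ℕ) (hN : StrictMono N) (hNpos : ∀ j, 0 < N j)
    (s : ℤ → ℂ)
    (hs : ∀ k : ℕ,
      Tendsto (fun j : ℕ => ((N j : ℂ))⁻¹ *
          ∑ n ∈ Finset.range (N j), (starRingEnd ℂ) (v n) * v (n + k))
        atTop (𝓝 (s (k : ℤ))))
    (hsym : ∀ k : ℕ, s (-(k : ℤ)) = (starRingEnd ℂ) (s (k : ℤ))) :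
    ∀ z : ℤ →₀ ℂ,
      0 ≤ (∑ i ∈ z.support, ∑ j ∈ z.support,
            (starRingEnd ℂ) (z i) * s (i - j) * z j).re ∧
        (∑ i ∈ z.support, ∑ j ∈ z.support,
            (starRingEnd ℂ) (z i) * s (i - j) * z j).im = 0 := by
  intro z
  have hb : ∀ a b n : ℕ, ‖(starRingEnd ℂ) (v (n + a)) * v (n + b)‖ ≤ C * C := by
    intro a b n
    rw [norm_mul, RCLike.norm_conj]
    exact mul_le_mul (hv _) (hv _) (norm_nonneg _) ((norm_nonneg _).trans (hv 0))
  have h1 : ∀ b k : ℕ, Tendsto (fun j : ℕ => ((N j : ℂ))⁻¹ *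
      ∑ n ∈ Finset.range (N j), (starRingEnd ℂ) (v (n + b)) * v (n + b + k))
      atTop (𝓝 (s (k : ℤ))) := fun b k =>
    avg_shift N hN b (fun n => (starRingEnd ℂ) (v n) * v (n + k)) (C * C)
      (fun n => by simpa using hb 0 k n) _ (hs k)
  have h2 : ∀ a b : ℕ, Tendsto (fun j : ℕ => ((N j : ℂ))⁻¹ *
      ∑ n ∈ Finset.range (N j), (starRingEnd ℂ) (v (n + b)) * v (n + a))
      atTop (𝓝 (s ((a : ℤ) - b))) := by
    intro a b
    rcases le_total b a with h | h
    · obtain ⟨k, rfl⟩ := Nat.exists_eq_add_of_le h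
      have := h1 b k
      simpa [add_assoc] using this
    · obtain ⟨k, rfl⟩ := Nat.exists_eq_add_of_le h
      have h3 := (Complex.continuous_conj.tendsto _).comp (h1 a k)
      rw [← hsym] at h3
      have e : ((a : ℤ) - ((a + k : ℕ) : ℤ)) = -(k : ℤ) := by push_cast; ring
      rw [e]
      refine h3.congr (fun j => ?_)
      simp [map_sum, add_assoc, mul_comm]
  obtain ⟨M, hM⟩ : ∃ M : ℕ, ∀ i ∈ z.support, 0 ≤ i + (M : ℤ) := by
    refine ⟨∑ i ∈ z.support, i.natAbs, fun i hi => ?_⟩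
    have := Finset.single_le_sum (f := fun i : ℤ => i.natAbs) (fun _ _ => Nat.zero_le _) hi
    omega
  have h4 : Tendsto (fun m : ℕ => ∑ i ∈ z.support, ∑ j ∈ z.support,
      (starRingEnd ℂ) (z i) * (((N m : ℂ))⁻¹ * ∑ n ∈ Finset.range (N m),
        (starRingEnd ℂ) (v (n + (j + M).toNat)) * v (n + (i + M).toNat)) * z j) atTop
      (𝓝 (∑ i ∈ z.support, ∑ j ∈ z.support, (starRingEnd ℂ) (z i) * s (i - j) * z j)) := by
    refine tendsto_finsetSum _ (fun i hi => tendsto_finsetSum _ (fun j hj => ?_))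
    have h5 := h2 (i + M).toNat (j + M).toNat
    rw [Int.toNat_of_nonneg (hM i hi), Int.toNat_of_nonneg (hM j hj),
      add_sub_add_right_eq_sub] at h5
    exact (h5.const_mul _).mul_const _
  have hcl : IsClosed {x : ℂ | 0 ≤ x.re ∧ x.im = 0} :=
    (isClosed_le continuous_const Complex.continuous_re).inter
      (isClosed_eq Complex.continuous_im continuous_const)
  refine hcl.mem_of_tendsto h4 (Eventually.of_forall fun m => ?_)
  have h6 : (∑ i ∈ z.support, ∑ j ∈ z.support,
      (starRingEnd ℂ) (z i) * (((N m : ℂ))⁻¹ * ∑ n ∈ Finset.range (N m),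
        (starRingEnd ℂ) (v (n + (j + M).toNat)) * v (n + (i + M).toNat)) * z j)
      = (((N m : ℝ)⁻¹ * ∑ n ∈ Finset.range (N m),
        Complex.normSq (∑ i ∈ z.support, (starRingEnd ℂ) (z i) * v (n + (i + M).toNat)) : ℝ) : ℂ) := by
    push_cast
    simp_rw [← Complex.mul_conj, map_sum, Finset.sum_mul_sum, Finset.mul_sum, Finset.sum_mul]
    rw [Finset.sum_comm (s := Finset.range (N m)) (t := z.support)]
    refine Finset.sum_congr rfl fun i _ => ?_
    rw [Finset.sum_comm]
    refine Finset.sum_congr rfl fun n _ => Finset.sum_congr rfl fun j _ => ?_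
    simp only [map_mul, Complex.conj_conj]
    ring
  rw [h6]
  refine ⟨?_, Complex.ofReal_im _⟩
  rw [Complex.ofReal_re]
  exact mul_nonneg (by positivity) (Finset.sum_nonneg fun _ _ => Complex.normSq_nonneg _)
end
end
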